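/- For every integer n ≥ 1, the number of ascent sequences of length n that avoid both of the patterns 0011 and 0021 equals the Catalan number C_n = (1/(n+1))·binom(2n,n). -/

import Mathlib

/-- The number of ascents of a word of nonnegative integers. -/
def numAscents (w : List ℕ) : ℕ :=
  (w.zip w.tail).countP (fun p => p.1 < p.2)

/-- A word of nonnegative integers is an ascent sequence if it starts with 0 and
each subsequent entry is at most one more than the number of ascents preceding it. -/
def IsAscentSeq (w : List ℕ) : Prop :=
  w.head? = some 0 ∧
    ∀ i (h : i < w.length), 1 ≤ i → w.get ⟨i, h⟩ ≤ numAscents (w.take i) + 1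

/-- A word `π` contains the pattern `τ` if it has a subsequence order-isomorphic to `τ`. -/
def Contains (π τ : List ℕ) : Prop :=
  ∃ f : Fin τ.length → Fin π.length, StrictMono f ∧
    ∀ i j, (π.get (f i) < π.get (f j) ↔ τ.get i < τ.get j) ∧
      (π.get (f i) > π.get (f j) ↔ τ.get i > τ.get j)

/-- A word avoids a pattern if it does not contain it. -/
def Avoids (π τ : List ℕ) : Prop := ¬ Contains π τ

/-- The number of ascent sequences of length `n` avoiding every pattern in `T`. -/
noncomputable def avoiderCount (n : ℕ) (T : List (List ℕ)) : ℕ :=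
  {w : List ℕ | w.length = n ∧ IsAscentSeq w ∧ ∀ τ ∈ T, Avoids w τ}.ncard

open Finset.HasAntidiagonal (antidiagonal mem_antidiagonal)
open scoped List

/-- Number of continuations of length `m` from a state with label `(x, y)`. -/
def labelCount : ℕ → ℕ → ℕ → ℕ
  | 0, _, _ => 1
  | m + 1, x, y => ∑ p ∈ antidiagonal x, labelCount m p.1 (p.2 + y) +
      ∑ j ∈ Finset.range (y + 1), labelCount m x j

/-- Number of continuations of length `m` of the word `0 1 ⋯ k`. -/
def initialCount : ℕ → ℕ → ℕ
  | 0, _ => 1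
  | m + 1, k => initialCount m (k + 1) + ∑ p ∈ antidiagonal k, labelCount m p.1 p.2

/-- The coefficient of `z ^ n` in the `j`-th power of the Catalan generating function. -/
def ballot : ℕ → ℕ → ℕ
  | 0, _ => 1
  | _ + 1, 0 => 0
  | n + 1, j + 1 => ballot (n + 1) j + ballot n (j + 2)

theorem ballot_succ_succ (n j : ℕ) :
    ballot (n + 1) (j + 1) = ballot (n + 1) j + ballot n (j + 2) := by
  rw [ballot]

theorem ballot_succ_zero (n : ℕ) : ballot (n + 1) 0 = 0 := by rw [ballot]

theorem ballot_zero (j : ℕ) : ballot 0 j = 1 := by rw [ballot]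

theorem ballot_succ_add_choose (n j : ℕ) :
    ballot (n + 1) (j + 1) + (2 * n + 2 + j).choose n = (2 * n + 2 + j).choose (n + 1) := by
  induction n generalizing j with
  | zero =>
    induction j with
    | zero => simp [ballot]
    | succ j ih =>
      rw [ballot_succ_succ, ballot_zero]
      simp at ih ⊢
      omega
  | succ n ihn =>
    induction j with
    | zero =>
      have h := ihn 1
      have h1 := Nat.choose_succ_succ (2 * n + 3) n
      have h2 := Nat.choose_succ_succ (2 * n + 3) (n + 1)
      have h3 : (2 * n + 3).choose (n + 2) = (2 * n + 3).choose (n + 1) :=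
        Nat.choose_symm_of_eq_add (by omega)
      rw [ballot_succ_succ, ballot_succ_zero]
      simp only [Nat.succ_eq_add_one] at *
      ring_nf at *
      omega
    | succ j ihj =>
      have h := ihn (j + 2)
      have h1 := Nat.choose_succ_succ (2 * (n + 1) + 2 + j) n
      have h2 := Nat.choose_succ_succ (2 * (n + 1) + 2 + j) (n + 1)
      rw [ballot_succ_succ]
      simp only [Nat.succ_eq_add_one] at *
      ring_nf at *
      omega

theorem ballot_one_eq_catalan (n : ℕ) : ballot n 1 = catalan n := by
  cases n with
  | zero => simp [ballot]
  | succ n =>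
    have h := ballot_succ_add_choose n 0
    have hc := succ_mul_catalan_eq_centralBinom (n + 1)
    rw [Nat.centralBinom] at hc
    have hs : (2 * n + 2).choose (n + 2) = (2 * n + 2).choose n :=
      Nat.choose_symm_of_eq_add (by omega)
    have hm := Nat.choose_succ_right_eq (2 * n + 2) (n + 1)
    rw [show n + 1 + 1 = n + 2 by rfl, hs, show 2 * n + 2 - (n + 1) = n + 1 by omega] at hm
    rw [show 2 * (n + 1) = 2 * n + 2 by ring] at hc
    simp only [add_zero, zero_add] at h
    apply Nat.eq_of_mul_eq_mul_left (show 0 < n + 1 + 1 by omega)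
    rw [hc]
    nlinarith

/-- The partial sums of the coefficients of the `(y + 2)`-nd power. -/
def ballotSum (N y : ℕ) : ℕ := ∑ M ∈ Finset.range (N + 1), ballot M (y + 2)

theorem ballotSum_succ_succ (N y : ℕ) :
    ballotSum (N + 1) (y + 1) = ballotSum (N + 1) y + ballotSum N (y + 2) := by
  simp only [ballotSum]
  rw [Finset.sum_range_succ', Finset.sum_range_succ' (fun M => ballot M (y + 2))]
  simp only [ballot_zero, ballot_succ_succ _ (y + 2), Finset.sum_add_distrib]
  ring

theorem sum_antidiagonal_ballotSum (N y : ℕ) :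
    ∑ p ∈ antidiagonal N, ballotSum p.1 (p.2 + y) = ballotSum N (y + 1) := by
  induction N generalizing y with
  | zero => simp [ballotSum, ballot]
  | succ N ih =>
    rw [Finset.Nat.sum_antidiagonal_succ', ballotSum_succ_succ, ← ih (y + 1)]
    simp only [zero_add]
    congr 1
    refine Finset.sum_congr rfl fun p _ => ?_
    rw [add_right_comm, add_assoc]

theorem sum_range_ballot (N y : ℕ) :
    ∑ j ∈ Finset.range y, ballot N (j + 2) = ballot (N + 1) y := by
  induction y with
  | zero => simp [ballot]
  | succ y ih => rw [Finset.sum_range_succ, ih, ballot_succ_succ]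

theorem ballotSum_succ (N y : ℕ) :
    ballotSum (N + 1) y =
      1 + ballotSum N (y + 1) + ∑ j ∈ Finset.range (y + 1), ballotSum N j := by
  simp only [ballotSum]
  rw [Finset.sum_comm]
  simp only [sum_range_ballot]
  rw [Finset.sum_range_succ', ballot_zero, add_assoc, ← Finset.sum_add_distrib, add_comm]
  congr 1
  refine Finset.sum_congr rfl fun M _ => ?_
  rw [ballot_succ_succ]
  ring

theorem one_add_ballotSum (N : ℕ) : 1 + ballotSum N 1 = ballot (N + 2) 1 := by
  induction N with
  | zero => simp [ballotSum, ballot]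
  | succ N ih =>
    simp only [ballotSum] at ih ⊢
    rw [Finset.sum_range_succ, ← add_assoc, ih, ballot_succ_succ (N + 2) 0, ballot_succ_zero,
      ballot_succ_succ (N + 1) 1]
    simp

theorem sum_antidiagonal_assoc (n : ℕ) (f : ℕ → ℕ → ℕ → ℕ) :
    ∑ p ∈ antidiagonal n,
        ∑ q ∈ antidiagonal p.2, f p.1 q.1 q.2 =
      ∑ p ∈ antidiagonal n,
        ∑ q ∈ antidiagonal p.1, f q.1 q.2 p.2 := by
  rw [Finset.sum_sigma', Finset.sum_sigma']
  refine Finset.sum_nbij' (fun s => ⟨(s.1.1 + s.2.1, s.2.2), (s.1.1, s.2.1)⟩)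
    (fun s => ⟨(s.2.1, s.2.2 + s.1.2), (s.2.2, s.1.2)⟩) ?_ ?_ ?_ ?_ ?_
  · rintro ⟨⟨a, b⟩, ⟨c, d⟩⟩ h
    simp only [Finset.mem_sigma, mem_antidiagonal, and_true] at h ⊢
    omega
  · rintro ⟨⟨a, b⟩, ⟨c, d⟩⟩ h
    simp only [Finset.mem_sigma, mem_antidiagonal, and_true] at h ⊢
    omega
  · rintro ⟨⟨a, b⟩, ⟨c, d⟩⟩ h
    simp only [Finset.mem_sigma, mem_antidiagonal] at h
    obtain ⟨rfl, rfl⟩ := h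
    rfl
  · rintro ⟨⟨a, b⟩, ⟨c, d⟩⟩ h
    simp only [Finset.mem_sigma, mem_antidiagonal] at h
    obtain ⟨rfl, rfl⟩ := h
    rfl
  · intro s _
    rfl

theorem sum_antidiagonal_labelCount (N y : ℕ) :
    ∑ p ∈ antidiagonal N, labelCount p.1 p.2 y = ballotSum N y := by
  induction N using Nat.strong_induction_on generalizing y with
  | _ N ih =>
  cases N with
  | zero => simp [labelCount, ballotSum, ballot]
  | succ N =>
    rw [Finset.Nat.sum_antidiagonal_succ, ballotSum_succ, ← sum_antidiagonal_ballotSum]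
    simp only [labelCount, Finset.sum_add_distrib]
    rw [add_assoc]
    congr 2
    · rw [sum_antidiagonal_assoc N fun a b c => labelCount a b (c + y)]
      exact Finset.sum_congr rfl fun p hp =>
        ih p.1 (by have := mem_antidiagonal.1 hp; omega) (p.2 + y)
    · rw [Finset.sum_comm]
      exact Finset.sum_congr rfl fun j _ => ih N (Nat.lt_succ_self N) j

theorem initialCount_succ_eq (m k : ℕ) :
    initialCount (m + 1) k = 1 + ∑ p ∈ antidiagonal m,
      ∑ q ∈ antidiagonal (p.2 + k), labelCount p.1 q.1 q.2 := by
  induction m generalizing k with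
  | zero => simp [initialCount]
  | succ m ih =>
    rw [initialCount, ih, Finset.Nat.sum_antidiagonal_succ', zero_add, add_assoc]
    congr 1
    rw [add_comm]
    congr 1
    refine Finset.sum_congr rfl fun p _ => ?_
    rw [add_right_comm, add_assoc]

theorem initialCount_eq_catalan (m : ℕ) : initialCount m 0 = catalan (m + 1) := by
  cases m with
  | zero => simp [initialCount]
  | succ m =>
    rw [← ballot_one_eq_catalan, ← one_add_ballotSum, initialCount_succ_eq]
    simp only [add_zero, sum_antidiagonal_assoc m labelCount, sum_antidiagonal_labelCount]
    rw [← sum_antidiagonal_ballotSum m 0]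
    rfl

theorem snoc_sublist_snoc {α : Type*} {l w : List α} {a b : α} :
    l ++ [b] <+ w ++ [a] ↔ l ++ [b] <+ w ∨ b = a ∧ l <+ w := by
  rw [← List.reverse_sublist, ← List.reverse_sublist (l₂ := w), ← List.reverse_sublist (l₁ := l)]
  simp only [List.reverse_append, List.reverse_singleton, List.singleton_append]
  rw [List.sublist_cons_iff]
  simp

theorem pair_sublist_snoc {w : List ℕ} {x y a : ℕ} :
    [x, y] <+ w ++ [a] ↔ [x, y] <+ w ∨ y = a ∧ x ∈ w := by
  simpa using snoc_sublist_snoc (l := [x]) (w := w) (a := a) (b := y)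

theorem triple_sublist_snoc {w : List ℕ} {x y z a : ℕ} :
    [x, y, z] <+ w ++ [a] ↔ [x, y, z] <+ w ∨ z = a ∧ [x, y] <+ w :=
  snoc_sublist_snoc (l := [x, y])

theorem quadruple_sublist_snoc {w : List ℕ} {x y z t a : ℕ} :
    [x, y, z, t] <+ w ++ [a] ↔ [x, y, z, t] <+ w ∨ t = a ∧ [x, y, z] <+ w :=
  snoc_sublist_snoc (l := [x, y, z])

theorem sublist_of_strictMono {w : List ℕ} {f : Fin 4 → Fin w.length} (hf : StrictMono f) :
    [w.get (f 0), w.get (f 1), w.get (f 2), w.get (f 3)] <+ w := by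
  rw [List.sublist_iff_exists_fin_orderEmbedding_get_eq]
  refine ⟨OrderEmbedding.ofStrictMono f hf, fun i => ?_⟩
  fin_cases i <;> rfl

theorem avoids_iff_forall_not_sublist {w : List ℕ} :
    (∀ τ ∈ [[0, 0, 1, 1], [0, 0, 2, 1]], Avoids w τ) ↔
      ∀ x y z, x < z → z ≤ y → ¬ [x, x, y, z] <+ w := by
  constructor
  · intro h x y z hxz hzy hs
    obtain ⟨f, hf⟩ := List.sublist_iff_exists_fin_orderEmbedding_get_eq.1 hs
    rcases hzy.eq_or_lt with rfl | hlt
    · refine h [0, 0, 1, 1] (by simp) ⟨f, f.strictMono, fun i j => ?_⟩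
      rw [← hf, ← hf]
      fin_cases i <;> fin_cases j <;> simp <;> omega
    · refine h [0, 0, 2, 1] (by simp) ⟨f, f.strictMono, fun i j => ?_⟩
      rw [← hf, ← hf]
      fin_cases i <;> fin_cases j <;> simp <;> omega
  · rintro h τ hτ ⟨f, hf, hc⟩
    simp only [List.mem_cons, List.not_mem_nil, or_false] at hτ
    rcases hτ with rfl | rfl
    · have h01 := hc (0 : Fin 4) (1 : Fin 4)
      have h02 := hc (0 : Fin 4) (2 : Fin 4)
      have h03 := hc (0 : Fin 4) (3 : Fin 4)
      have h23 := hc (2 : Fin 4) (3 : Fin 4)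
      have hs := sublist_of_strictMono (f := f) hf
      simp at h01 h02 h03 h23 hs
      rw [show w[(f (1 : Fin 4)).1] = w[(f (0 : Fin 4)).1] by omega] at hs
      exact h _ _ _ (by omega) (by omega) hs
    · have h01 := hc (0 : Fin 4) (1 : Fin 4)
      have h02 := hc (0 : Fin 4) (2 : Fin 4)
      have h03 := hc (0 : Fin 4) (3 : Fin 4)
      have h23 := hc (2 : Fin 4) (3 : Fin 4)
      have hs := sublist_of_strictMono (f := f) hf
      simp at h01 h02 h03 h23 hs
      rw [show w[(f (1 : Fin 4)).1] = w[(f (0 : Fin 4)).1] by omega] at hs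
      exact h _ _ _ (by omega) (by omega) hs

theorem isAscentSeq_snoc {w : List ℕ} (hw : w ≠ []) {a : ℕ} :
    IsAscentSeq (w ++ [a]) ↔ IsAscentSeq w ∧ a ≤ numAscents w + 1 := by
  have hpos := List.length_pos_iff.2 hw
  unfold IsAscentSeq
  rw [List.head?_append_of_ne_nil _ hw, and_assoc]
  refine and_congr_right fun _ => ⟨fun h => ⟨fun i hi h1 => ?_, ?_⟩, fun h i hi h1 => ?_⟩
  · have := h i (by simp; omega) h1
    rw [List.take_append_of_le_length hi.le] at this
    simpa [List.getElem_append_left hi] using this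
  · simpa using h w.length (by simp) hpos
  · rcases (show i < w.length ∨ i = w.length by simp at hi; omega) with hlt | rfl
    · rw [List.take_append_of_le_length hlt.le]
      simpa [List.getElem_append_left hlt] using h.1 i hlt h1
    · simpa using h.2

theorem numAscents_cons_cons (a b : ℕ) (w : List ℕ) :
    numAscents (a :: b :: w) = numAscents (b :: w) + if a < b then 1 else 0 := by
  simp [numAscents, List.countP_cons]

theorem numAscents_snoc_snoc (u : List ℕ) (l a : ℕ) :
    numAscents (u ++ [l] ++ [a]) = numAscents (u ++ [l]) + if l < a then 1 else 0 := by
  induction u with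
  | nil => simp [numAscents, List.countP_cons]
  | cons b u ih =>
    cases u with
    | nil =>
      simp only [List.nil_append, List.cons_append, numAscents_cons_cons] at ih ⊢
      simp [numAscents]
      omega
    | cons c u =>
      simp only [List.cons_append, numAscents_cons_cons] at ih ⊢
      omega

/-- The words counted by `avoiderCount`. -/
def IsAvoider (w : List ℕ) : Prop :=
  IsAscentSeq w ∧ ∀ τ ∈ [[0, 0, 1, 1], [0, 0, 2, 1]], Avoids w τ

/-- Appending `a` to `w` would create an occurrence of one of the two patterns. -/
def IsBlocked (w : List ℕ) (a : ℕ) : Prop :=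
  ∃ x y, x < a ∧ a ≤ y ∧ [x, x, y] <+ w

open Classical in
/-- The letters that can be appended to an avoider `w`. -/
noncomputable def nextLetters (w : List ℕ) : Finset ℕ :=
  {a ∈ Finset.range (numAscents w + 2) | ¬ IsBlocked w a}

theorem mem_nextLetters {w : List ℕ} {a : ℕ} :
    a ∈ nextLetters w ↔ a ≤ numAscents w + 1 ∧ ¬ IsBlocked w a := by
  simp only [nextLetters, Finset.mem_filter, Finset.mem_range, Nat.lt_succ_iff]

theorem isBlocked_snoc {w : List ℕ} {v a : ℕ} :
    IsBlocked (w ++ [v]) a ↔ IsBlocked w a ∨ a ≤ v ∧ ∃ x < a, [x, x] <+ w := by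
  simp only [IsBlocked, triple_sublist_snoc]
  grind

theorem isAvoider_snoc {w : List ℕ} (hw : w ≠ []) {a : ℕ} :
    IsAvoider (w ++ [a]) ↔ IsAvoider w ∧ a ∈ nextLetters w := by
  simp only [IsAvoider, isAscentSeq_snoc hw, avoids_iff_forall_not_sublist, mem_nextLetters,
    quadruple_sublist_snoc, IsBlocked]
  grind

theorem isAvoider_of_append {w v : List ℕ} (hw : w ≠ []) (h : IsAvoider (w ++ v)) :
    IsAvoider w := by
  induction v using List.reverseRecOn with
  | nil => simpa using h
  | append_singleton v a ih =>
    rw [← List.append_assoc, isAvoider_snoc (by simp [hw])] at h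
    exact ih h.1

/-- The number of ways to append `m` letters one after another. -/
noncomputable def extensionCount : ℕ → List ℕ → ℕ
  | 0, _ => 1
  | m + 1, w => ∑ a ∈ nextLetters w, extensionCount m (w ++ [a])

theorem exists_finset_extensions (m : ℕ) {w : List ℕ} (hw : w ≠ []) (h : IsAvoider w) :
    ∃ s : Finset (List ℕ), s.card = extensionCount m w ∧
      ∀ v, v ∈ s ↔ v.length = m ∧ IsAvoider (w ++ v) := by
  induction m generalizing w with
  | zero =>
    refine ⟨{[]}, by simp [extensionCount], fun v => ?_⟩
    rw [Finset.mem_singleton, List.length_eq_zero_iff]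
    exact ⟨by rintro rfl; simpa using h, And.left⟩
  | succ m ih =>
    have hext : ∀ a, ∃ s : Finset (List ℕ), a ∈ nextLetters w →
        s.card = extensionCount m (w ++ [a]) ∧
          ∀ v, v ∈ s ↔ v.length = m ∧ IsAvoider (w ++ [a] ++ v) := by
      intro a
      by_cases ha : a ∈ nextLetters w
      · obtain ⟨s, hs⟩ := ih (w := w ++ [a]) (by simp) ((isAvoider_snoc hw).2 ⟨h, ha⟩)
        exact ⟨s, fun _ => hs⟩
      · exact ⟨∅, fun h => absurd h ha⟩
    choose s hs using hext
    refine ⟨((nextLetters w).sigma s).map ⟨fun p => p.1 :: p.2, ?_⟩, ?_, fun v => ?_⟩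
    · rintro ⟨a, v⟩ ⟨b, u⟩ hab
      simp only [List.cons.injEq] at hab
      obtain ⟨rfl, rfl⟩ := hab
      rfl
    · rw [Finset.card_map, Finset.card_sigma, extensionCount]
      exact Finset.sum_congr rfl fun a ha => (hs a ha).1
    · simp only [Finset.mem_map, Finset.mem_sigma, Sigma.exists]
      constructor
      · rintro ⟨a, u, ⟨ha, hu⟩, rfl⟩
        have := ((hs a ha).2 u).1 hu
        exact ⟨congrArg Nat.succ this.1, by simpa using! this.2⟩
      · rintro ⟨hl, hv⟩
        cases v with
        | nil => simp at hl
        | cons a u =>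
          have hau : IsAvoider (w ++ [a] ++ u) := by simpa using hv
          have ha := ((isAvoider_snoc hw).1 (isAvoider_of_append (by simp) hau)).2
          exact ⟨a, u, ⟨ha, ((hs a ha).2 u).2 ⟨by simpa using hl, hau⟩⟩, rfl⟩

/-- An avoider in which some letter is repeated, `x` being the least such letter, with `y + 1`
choices for a next letter exceeding `x`. -/
structure HasLabel (w : List ℕ) (x y : ℕ) : Prop where
  mem_of_le : ∀ v ≤ x, v ∈ w
  repeated : [x, x] <+ w
  le_of_repeated : ∀ v, [v, v] <+ w → x ≤ v
  le_numAscents : ∀ v ∈ w, v ≤ numAscents w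
  card_eq : {a ∈ nextLetters w | x < a}.card = y + 1
  exists_last : ∃ u l, w = u ++ [l] ∧ x ≤ l ∧ ∀ a ∈ nextLetters w, x < a → l < a

namespace HasLabel

variable {w : List ℕ} {x y : ℕ}

theorem not_isBlocked_of_le (h : HasLabel w x y) {v : ℕ} (hv : v ≤ x) : ¬ IsBlocked w v := by
  rintro ⟨t, z, ht, -, hs⟩
  have := h.le_of_repeated t ((List.sublist_append_left [t, t] [z]).trans hs)
  omega

theorem mem_nextLetters_of_le (h : HasLabel w x y) {v : ℕ} (hv : v ≤ x) : v ∈ nextLetters w :=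
  mem_nextLetters.2 ⟨(h.le_numAscents v (h.mem_of_le v hv)).trans (Nat.le_succ _),
    h.not_isBlocked_of_le hv⟩

theorem snoc_of_le (h : HasLabel w x y) {v : ℕ} (hv : v ≤ x) :
    HasLabel (w ++ [v]) v (x - v + y) := by
  obtain ⟨u, l, hw, hxl, hl⟩ := h.exists_last
  have hasc : numAscents (w ++ [v]) = numAscents w := by
    rw [hw, numAscents_snoc_snoc, if_neg (by omega), add_zero]
  have hnext : nextLetters (w ++ [v]) = nextLetters w := by
    ext a
    rw [mem_nextLetters, mem_nextLetters, hasc, isBlocked_snoc]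
    have : ¬ (a ≤ v ∧ ∃ t < a, [t, t] <+ w) := by
      rintro ⟨hav, t, hta, ht⟩
      have := h.le_of_repeated t ht
      omega
    simp only [this, or_false]
  refine ⟨fun t ht => ?_, ?_, fun t ht => ?_, fun t ht => ?_, ?_, w, v, rfl, le_rfl, ?_⟩
  · exact List.mem_append_left _ (h.mem_of_le t (ht.trans hv))
  · exact pair_sublist_snoc.2 (Or.inr ⟨rfl, h.mem_of_le v hv⟩)
  · rcases pair_sublist_snoc.1 ht with ht | ⟨rfl, -⟩
    · exact hv.trans (h.le_of_repeated t ht)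
    · exact le_rfl
  · rw [hasc]
    rcases List.mem_append.1 ht with ht | ht
    · exact h.le_numAscents t ht
    · rw [List.mem_singleton.1 ht]
      exact h.le_numAscents v (h.mem_of_le v hv)
  · rw [hnext]
    have : {a ∈ nextLetters w | v < a} =
        Finset.Ioc v x ∪ {a ∈ nextLetters w | x < a} := by
      ext a
      simp only [Finset.mem_filter, Finset.mem_union, Finset.mem_Ioc]
      have := fun ha : a ≤ x => h.mem_nextLetters_of_le ha
      grind
    rw [this, Finset.card_union_of_disjoint, h.card_eq, Nat.card_Ioc, add_assoc]
    rw [Finset.disjoint_left]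
    intro a ha hb
    simp only [Finset.mem_filter, Finset.mem_Ioc] at ha hb
    omega
  · exact fun a _ ha => ha

theorem snoc_of_lt (h : HasLabel w x y) {v : ℕ} (hv : v ∈ nextLetters w) (hxv : x < v) :
    HasLabel (w ++ [v]) x {a ∈ nextLetters w | v < a}.card := by
  obtain ⟨u, l, hw, hxl, hl⟩ := h.exists_last
  have hasc : numAscents (w ++ [v]) = numAscents w + 1 := by
    have := hl v hv hxv
    rw [hw, numAscents_snoc_snoc, if_pos this]
  have hvasc := (mem_nextLetters.1 hv).1
  have hnext : {a ∈ nextLetters (w ++ [v]) | x < a} =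
      insert (numAscents w + 2) {a ∈ nextLetters w | v < a} := by
    ext a
    simp only [Finset.mem_filter, Finset.mem_insert, mem_nextLetters, hasc, isBlocked_snoc]
    have hblocked : ¬ IsBlocked w (numAscents w + 2) := by
      rintro ⟨t, z, -, hz, hs⟩
      have := h.le_numAscents z (hs.subset (by simp))
      omega
    have hle : (∃ t < a, [t, t] <+ w) ↔ x < a :=
      ⟨fun ⟨t, hta, ht⟩ => (h.le_of_repeated t ht).trans_lt hta, fun hxa => ⟨x, hxa, h.repeated⟩⟩
    rw [hle]
    constructor
    · rintro ⟨⟨ha, hb⟩, hxa⟩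
      grind
    · rintro (rfl | ⟨⟨ha, hb⟩, hva⟩)
      · grind
      · grind
  refine ⟨fun t ht => ?_, ?_, fun t ht => ?_, fun t ht => ?_, ?_, w, v, rfl, hxv.le, ?_⟩
  · exact List.mem_append_left _ (h.mem_of_le t ht)
  · exact h.repeated.trans (List.sublist_append_left _ _)
  · rcases pair_sublist_snoc.1 ht with ht | ⟨rfl, -⟩
    · exact h.le_of_repeated t ht
    · exact hxv.le
  · rw [hasc]
    rcases List.mem_append.1 ht with ht | ht
    · exact (h.le_numAscents t ht).trans (Nat.le_succ _)
    · rwa [List.mem_singleton.1 ht]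
  · rw [hnext, Finset.card_insert_of_notMem]
    simp only [Finset.mem_filter, mem_nextLetters]
    omega
  · intro a ha hxa
    have : a ∈ {a ∈ nextLetters (w ++ [v]) | x < a} := Finset.mem_filter.2 ⟨ha, hxa⟩
    rw [hnext, Finset.mem_insert, Finset.mem_filter] at this
    omega

end HasLabel

theorem sum_card_filter_lt (s : Finset ℕ) (f : ℕ → ℕ) :
    ∑ v ∈ s, f {a ∈ s | v < a}.card = ∑ j ∈ Finset.range s.card, f j := by
  induction s using Finset.induction_on_min with
  | empty => simp
  | insert m s hm ih =>
    have hms : m ∉ s := fun h => lt_irrefl m (hm m h)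
    rw [Finset.sum_insert hms, Finset.card_insert_of_notMem hms, Finset.sum_range_succ, ← ih,
      add_comm]
    congr 1
    · refine Finset.sum_congr rfl fun v hv => ?_
      rw [Finset.filter_insert, if_neg (hm v hv).le.not_gt]
    · rw [Finset.filter_insert, if_neg (lt_irrefl m), Finset.filter_true_of_mem hm]

theorem extensionCount_eq_labelCount (m : ℕ) {w : List ℕ} {x y : ℕ} (h : HasLabel w x y) :
    extensionCount m w = labelCount m x y := by
  induction m generalizing w x y with
  | zero => rfl
  | succ m ih =>
    have hle : {a ∈ nextLetters w | ¬ x < a} = Finset.range (x + 1) := by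
      ext a
      have := fun ha : a ≤ x => h.mem_nextLetters_of_le ha
      simp only [Finset.mem_filter, Finset.mem_range]
      grind
    have hsub : ∀ v, x < v → {a ∈ nextLetters w | v < a} =
        {a ∈ {a ∈ nextLetters w | x < a} | v < a} := by
      intro v hv
      rw [Finset.filter_filter]
      exact Finset.filter_congr fun a _ => by omega
    rw [extensionCount, labelCount, ← Finset.sum_filter_not_add_sum_filter _ (x < ·), hle,
      Finset.Nat.sum_antidiagonal_eq_sum_range_succ fun a b => labelCount m a (b + y), ← h.card_eq,
      ← sum_card_filter_lt]
    congr 1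
    · exact Finset.sum_congr rfl fun v hv => ih (h.snoc_of_le (by simpa [Nat.lt_succ_iff] using hv))
    · refine Finset.sum_congr rfl fun v hv => ?_
      rw [Finset.mem_filter] at hv
      rw [ih (h.snoc_of_lt hv.1 hv.2), hsub v hv.2]

theorem numAscents_range (k : ℕ) : numAscents (List.range (k + 1)) = k := by
  induction k with
  | zero => rfl
  | succ k ih =>
    rw [List.range_succ (n := k + 1), List.range_succ (n := k), numAscents_snoc_snoc,
      ← List.range_succ, ih, if_pos (Nat.lt_succ_self k)]

theorem not_pair_sublist_range (n v : ℕ) : ¬ [v, v] <+ List.range n := fun h => by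
  simpa using List.nodup_range.sublist h

theorem not_isBlocked_range (n a : ℕ) : ¬ IsBlocked (List.range n) a := by
  rintro ⟨x, y, -, -, h⟩
  exact not_pair_sublist_range n x ((List.sublist_append_left [x, x] [y]).trans h)

theorem nextLetters_range (k : ℕ) : nextLetters (List.range (k + 1)) = Finset.range (k + 2) := by
  ext a
  simp only [mem_nextLetters, numAscents_range, not_isBlocked_range, Finset.mem_range]
  grind

theorem hasLabel_range_snoc {k v : ℕ} (hv : v ≤ k) :
    HasLabel (List.range (k + 1) ++ [v]) v (k - v) := by
  have hasc : numAscents (List.range (k + 1) ++ [v]) = k := by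
    rw [List.range_succ, numAscents_snoc_snoc, ← List.range_succ, numAscents_range,
      if_neg (by omega), add_zero]
  have hnext : nextLetters (List.range (k + 1) ++ [v]) = Finset.range (k + 2) := by
    ext a
    simp only [mem_nextLetters, hasc, isBlocked_snoc, not_isBlocked_range,
      not_pair_sublist_range, Finset.mem_range]
    grind
  refine ⟨fun t ht => ?_, ?_, fun t ht => ?_, fun t ht => ?_, ?_, _, v, rfl, le_rfl, ?_⟩
  · exact List.mem_append_left _ (List.mem_range.2 (by omega))
  · exact pair_sublist_snoc.2 (Or.inr ⟨rfl, List.mem_range.2 (by omega)⟩)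
  · rcases pair_sublist_snoc.1 ht with ht | ⟨rfl, -⟩
    · exact absurd ht (not_pair_sublist_range _ t)
    · exact le_rfl
  · rw [hasc]
    simp only [List.mem_append, List.mem_range, List.mem_singleton] at ht
    omega
  · have : {a ∈ Finset.range (k + 2) | v < a} = Finset.Ioo v (k + 2) := by
      ext a
      simp only [Finset.mem_filter, Finset.mem_range, Finset.mem_Ioo, and_comm]
    rw [hnext, this, Nat.card_Ioo]
    omega
  · exact fun a _ ha => ha

theorem extensionCount_range (m k : ℕ) :
    extensionCount m (List.range (k + 1)) = initialCount m k := by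
  induction m generalizing k with
  | zero => rfl
  | succ m ih =>
    rw [extensionCount, initialCount, nextLetters_range, Finset.sum_range_succ,
      ← List.range_succ, ih, add_comm,
      Finset.Nat.sum_antidiagonal_eq_sum_range_succ fun a b => labelCount m a b]
    congr 1
    refine Finset.sum_congr rfl fun v hv => extensionCount_eq_labelCount m (hasLabel_range_snoc ?_)
    simpa [Nat.lt_succ_iff] using hv

theorem isAvoider_singleton_zero : IsAvoider [0] := by
  refine ⟨⟨rfl, fun i h h1 => ?_⟩, avoids_iff_forall_not_sublist.2 fun x y z _ _ h => ?_⟩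
  · simp at h
    omega
  · simpa using h.length_le

/-- The number of ascent sequences of length `n` avoiding both patterns equals
the Catalan number $C_n$. -/
theorem catalan_count_avoid_0011_0021 (n : ℕ) (hn : 1 ≤ n) :
    avoiderCount n [[0,0,1,1], [0,0,2,1]] = catalan n := by
  obtain ⟨m, rfl⟩ : ∃ m, n = m + 1 := ⟨n - 1, by omega⟩
  obtain ⟨s, hcard, hs⟩ := exists_finset_extensions m (by simp) isAvoider_singleton_zero
  rw [← initialCount_eq_catalan, ← extensionCount_range, List.range_one, ← hcard,
    ← Finset.card_map ⟨List.cons 0, List.cons_injective⟩, ← Set.ncard_coe_finset]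
  refine congrArg Set.ncard (Set.ext fun v => ?_)
  simp only [Set.mem_ofPred_eq, Finset.coe_map, Set.mem_image, Finset.mem_coe, hs,
    Function.Embedding.coeFn_mk]
  constructor
  · rintro ⟨hl, hv⟩
    cases v with
    | nil => simp at hl
    | cons a u =>
      obtain rfl : a = 0 := by simpa using hv.1.1
      exact ⟨u, ⟨by simpa using hl, hv⟩, rfl⟩
  · rintro ⟨u, ⟨hl, hu⟩, rfl⟩
    exact ⟨by simpa using hl, hu⟩
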